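/- Let B be an invariant symmetric bilinear form on g, let p : g → ℂ be a smooth function that is infinitesimally invariant, i.e. dp(x).[y,x] = 0 for all x, y ∈ g, and let P : g → g be a smooth map satisfying B(P(x), y) = dp(x).y for all x, y ∈ g (P is the B-gradient of p). Then P is ad-equivariant: dP(x).[y,x] = [y, P(x)] for all x, y ∈ g. -/

import Mathlib

theorem stmt {g : Type*} [NormedAddCommGroup g] [NormedSpace ℂ g] [FiniteDimensional ℂ g]
    -- `lie` is the Lie bracket of the finite-dimensional complex Lie algebra `g`,
    -- given as bilinear data so that it is compatible with the normed space structure.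
    (lie : g →ₗ[ℂ] g →ₗ[ℂ] g)
    (lie_self : ∀ x : g, lie x x = 0)
    (lie_jacobi : ∀ x y z : g, lie x (lie y z) = lie (lie x y) z + lie y (lie x z))
    (B : g →ₗ[ℂ] g →ₗ[ℂ] ℂ)
    (hBsymm : ∀ x y : g, B x y = B y x)
    (hBinv : ∀ x y z : g, B (lie z x) y + B x (lie z y) = 0)
    (hBnd : ∀ x : g, (∀ y : g, B x y = 0) → x = 0)
    (p : g → ℂ) (hp : ContDiff ℂ ⊤ p)
    (hpinv : ∀ x y : g, fderiv ℂ p x (lie y x) = 0)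
    (P : g → g) (hPs : ContDiff ℂ ⊤ P)
    (hgrad : ∀ x y : g, B (P x) y = fderiv ℂ p x y)
    (x y : g) :
    fderiv ℂ P x (lie y x) = lie y (P x) := by
  have hP : HasFDerivAt P (fderiv ℂ P x) x :=
    (hPs.differentiable (by simp)).differentiableAt.hasFDerivAt
  have hdp : HasFDerivAt (fderiv ℂ p) (fderiv ℂ (fderiv ℂ p) x) x :=
    ((hp.fderiv_right (m := 1) (by simp)).differentiable (by simp)).differentiableAt.hasFDerivAt
  have hsymm : ∀ v w : g, fderiv ℂ (fderiv ℂ p) x v w = fderiv ℂ (fderiv ℂ p) x w v :=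
    second_derivative_symmetric
      (fun a => (hp.differentiable (by simp)).differentiableAt.hasFDerivAt) hdp
  -- The `B`-dual of the derivative of the gradient is the Hessian.
  have hhess (v w : g) : B (fderiv ℂ P x v) w = fderiv ℂ (fderiv ℂ p) x v w := by
    have h₁ : HasFDerivAt (fun a => B (P a) w)
        ((B.flip w).toContinuousLinearMap.comp (fderiv ℂ P x)) x :=
      (B.flip w).toContinuousLinearMap.hasFDerivAt.comp x hP
    have h₂ := hdp.clm_apply (hasFDerivAt_const w x)
    simp only [hgrad] at h₁
    simpa using DFunLike.congr_fun (h₁.unique h₂) v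
  -- Differentiating the invariance identity in direction `z`.
  have hdiff (z : g) : fderiv ℂ (fderiv ℂ p) x z (lie y x) + fderiv ℂ p x (lie y z) = 0 := by
    have h₁ := hdp.clm_apply (lie y).toContinuousLinearMap.hasFDerivAt
    have h₂ : HasFDerivAt (fun a => fderiv ℂ p a ((lie y).toContinuousLinearMap a))
        (0 : g →L[ℂ] ℂ) x := by
      simpa [hpinv] using hasFDerivAt_const (0 : ℂ) x
    simpa [add_comm] using DFunLike.congr_fun (h₁.unique h₂) z
  refine sub_eq_zero.mp (hBnd _ fun z => ?_)
  rw [map_sub, LinearMap.sub_apply, hhess, hsymm]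
  linear_combination hdiff z - hBinv (P x) z y + hgrad x (lie y z)
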